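/- Let p ≥ 11 be a prime, let n be an integer with 4 ≤ 2n ≤ p−7, and let i be an integer with 0 ≤ i ≤ p−3−2n. Then the rational number C(2(p−1)−2n−i, p−1)·𝔅_{p−1} has p-adic valuation ≥ 0 (it is a p-adic integer), and C(2(p−1)−2n−i, p−1)·𝔅_{p−1} ≡ −1/(2n+1+i) (mod p). -/

import Mathlib

open Finset

/-- The `k`-th divided Bernoulli number `𝔅_k = B_k / k`. -/
noncomputable def divB (k : ℕ) : ℚ := bernoulli k / k

/-- `x ≡ y (mod p^k)` for rationals: the `p`-adic valuation of `x - y` is at least `k`. -/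
def padicCong (p : ℕ) (k : ℤ) (x y : ℚ) : Prop := x = y ∨ k ≤ padicValRat p (x - y)

/-- A nonzero rational number of `p`-adic norm at most `p ^ (-k)` has valuation at least `k`. -/
lemma le_padicValRat_of_padicNorm_le {p : ℕ} (hp : p.Prime) {k : ℤ} {q : ℚ} (hq : q ≠ 0)
    (h : padicNorm p q ≤ (p : ℚ) ^ (-k)) : k ≤ padicValRat p q := by
  rw [padicNorm.eq_zpow_of_nonzero hq,
    zpow_le_zpow_iff_right₀ (by exact_mod_cast hp.one_lt)] at h
  omega

lemma padicNorm_natCast_eq_one {p m : ℕ} [Fact p.Prime] (h0 : 0 < m) (hm : m < p) :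
    padicNorm p (m : ℚ) = 1 :=
  (padicNorm.nat_eq_one_iff m).2 (Nat.not_dvd_of_pos_of_lt h0 hm)

lemma padicNorm_add_le {p : ℕ} [Fact p.Prime] {x y c : ℚ} (hx : padicNorm p x ≤ c)
    (hy : padicNorm p y ≤ c) : padicNorm p (x + y) ≤ c :=
  padicNorm.nonarchimedean.trans (max_le hx hy)

/-- The `p`-part of the von Staudt–Clausen theorem at index `p - 1`: `p B_{p-1} ≡ -1 (mod p)`. -/
lemma padicNorm_mul_bernoulli_add_one_le {p : ℕ} [hp : Fact p.Prime] (h2 : p ≠ 2) :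
    padicNorm p (p * bernoulli (p - 1) + 1) ≤ (p : ℚ)⁻¹ := by
  obtain ⟨k, hk⟩ := hp.out.even_sub_one h2
  have hk2 : 2 * k = p - 1 := by omega
  obtain ⟨T, hT⟩ := Bernoulli.vonStaudt_clausen k
  rw [hk2] at hT
  have hp1 := hp.out.one_lt
  have hmem : p ∈ {q ∈ range (p - 1 + 2) | q.Prime ∧ (q - 1) ∣ p - 1} := by
    simp only [mem_filter, mem_range, hp.out, dvd_refl, and_self, and_true]
    omega
  rw [← add_sum_erase _ _ hmem] at hT
  set S := ∑ q ∈ {q ∈ range (p - 1 + 2) | q.Prime ∧ (q - 1) ∣ p - 1}.erase p, (1 : ℚ) / q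
  have hSle : padicNorm p S ≤ 1 := by
    refine padicNorm.sum_le' (fun q hq => ?_) zero_le_one
    simp only [mem_erase, mem_filter] at hq
    rw [padicNorm.div, padicNorm.one,
      (padicNorm.nat_eq_one_iff q).2 fun h =>
        hq.1 ((Nat.prime_dvd_prime_iff_eq hp.out hq.2.2.1).1 h).symm]
    norm_num
  have hp0 : (p : ℚ) ≠ 0 := by exact_mod_cast hp.out.ne_zero
  have key : (p : ℚ) * bernoulli (p - 1) + 1 = p * (T + -S) := by
    rw [hT]
    field_simp
    ring
  rw [key, padicNorm.mul, padicNorm.padicNorm_p_of_prime]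
  refine mul_le_of_le_one_right (by positivity)
    (padicNorm_add_le (padicNorm.of_int T) (by rwa [padicNorm.neg]))

lemma choose_add_sub_one_modEq_one {p r : ℕ} [hp : Fact p.Prime] (h0 : 0 < r) (hr : r < p) :
    (p + (r - 1)).choose p ≡ 1 [MOD p] := by
  have h := Choose.choose_modEq_choose_mod_mul_choose_div_nat (p := p) (n := p + (r - 1)) (k := p)
  rwa [Nat.add_mod_left, Nat.mod_self, Nat.choose_zero_right, Nat.add_div_left _ hp.out.pos,
    Nat.div_eq_of_lt (by omega), Nat.div_self hp.out.pos, Nat.choose_self] at h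

lemma mul_choose_add_pred (p r : ℕ) (hp : 0 < p) (hr : 0 < r) :
    r * (p - 1 + r).choose (p - 1) = p * (p + (r - 1)).choose p := by
  obtain ⟨p, rfl⟩ := Nat.exists_eq_add_one.2 hp
  obtain ⟨r, rfl⟩ := Nat.exists_eq_add_one.2 hr
  have h := Nat.choose_succ_right_eq (p + 1 + r) p
  simp only [Nat.add_sub_cancel]
  rw [show p + (r + 1) = p + 1 + r by ring]
  rw [show p + 1 + r - p = r + 1 by omega] at h
  linarith

/-- `C(p - 1 + r, p - 1) 𝔅_{p-1} ≡ -1 / (p - r) (mod p)`, where `p - r = s + 1`. -/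
lemma padicNorm_choose_mul_divB_add_le {p r s : ℕ} [hp : Fact p.Prime] (h2 : p ≠ 2) (hr : 0 < r)
    (hrs : r + s + 1 = p) :
    padicNorm p (((p - 1 + r).choose (p - 1) : ℚ) * divB (p - 1) + 1 / (s + 1 : ℚ)) ≤
      (p : ℚ)⁻¹ := by
  have hp1 := hp.out.one_lt
  set D := (p + (r - 1)).choose p
  have hC : (r : ℚ) * ((p - 1 + r).choose (p - 1) : ℚ) = p * D := by
    exact_mod_cast mul_choose_add_pred p r hp.out.pos hr
  have hr0 : (r : ℚ) ≠ 0 := by exact_mod_cast hr.ne'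
  have hs0 : ((s + 1 : ℕ) : ℚ) ≠ 0 := by exact_mod_cast s.succ_ne_zero
  have hq0 : ((p - 1 : ℕ) : ℚ) ≠ 0 := by exact_mod_cast (by omega : p - 1 ≠ 0)
  have hpc : (p : ℚ) = r + s + 1 := by exact_mod_cast hrs.symm
  have hqc : ((p - 1 : ℕ) : ℚ) = p - 1 := by push_cast [hp1.le]; ring
  have hD1 : padicNorm p ((D : ℚ) - 1) ≤ (p : ℚ)⁻¹ := by
    have h := Nat.modEq_iff_dvd.1 (choose_add_sub_one_modEq_one hr (by omega : r < p)).symm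
    have := (padicNorm.dvd_iff_norm_le (p := p) (n := 1) (z := (D : ℤ) - 1)).1 (by simpa using h)
    simpa using this
  have key : ((p - 1 + r).choose (p - 1) : ℚ) * divB (p - 1) + 1 / (s + 1 : ℚ) =
      ((D * (s + 1) : ℕ) * (p * bernoulli (p - 1) + 1) + (-((s + 1 : ℕ) * ((D : ℚ) - 1)) +
        p * ((p - 2 - s : ℤ) : ℚ))) / (r * (p - 1 : ℕ) * (s + 1 : ℕ)) := by
    rw [eq_div_iff (by positivity), divB]
    push_cast at hs0 ⊢
    field_simp
    rw [hqc]
    have hr' : (r : ℚ) = p - s - 1 := by linarith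
    linear_combination (bernoulli (p - 1) * (s + 1 : ℚ)) * hC + (p - 1 : ℚ) * hr'
  have hmul {m : ℚ} {x : ℚ} (hm : padicNorm p m ≤ 1) (hx : padicNorm p x ≤ (p : ℚ)⁻¹) :
      padicNorm p (m * x) ≤ (p : ℚ)⁻¹ := by
    rw [padicNorm.mul]
    exact (mul_le_of_le_one_left (padicNorm.nonneg x) hm).trans hx
  rw [key, padicNorm.div, padicNorm.mul, padicNorm.mul,
    padicNorm_natCast_eq_one hr (by omega),
    padicNorm_natCast_eq_one (by omega : 0 < p - 1) (by omega),
    padicNorm_natCast_eq_one s.succ_pos (by omega), mul_one, mul_one, div_one]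
  refine padicNorm_add_le (hmul (padicNorm.of_nat _) (padicNorm_mul_bernoulli_add_one_le h2))
    (padicNorm_add_le ?_ ?_)
  · rw [padicNorm.neg]
    exact hmul (padicNorm.of_nat _) hD1
  · rw [mul_comm]
    exact hmul (padicNorm.of_int _) padicNorm.padicNorm_p_of_prime.le

theorem stmt_17 (p n i : ℕ) (hp : p.Prime) (hp11 : 11 ≤ p)
    (hn1 : 4 ≤ 2 * n) (hn2 : 2 * n ≤ p - 7) (hi : i ≤ p - 3 - 2 * n) :
    0 ≤ padicValRat p ((Nat.choose (2 * (p - 1) - 2 * n - i) (p - 1) : ℚ) * divB (p - 1)) ∧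
    padicCong p 1 ((Nat.choose (2 * (p - 1) - 2 * n - i) (p - 1) : ℚ) * divB (p - 1))
      (-(1 / (2 * (n : ℚ) + 1 + (i : ℚ)))) := by
  have : Fact p.Prime := ⟨hp⟩
  have h := padicNorm_choose_mul_divB_add_le (p := p) (r := p - 1 - 2 * n - i) (s := 2 * n + i)
    (by omega) (by omega) (by omega)
  rw [show p - 1 + (p - 1 - 2 * n - i) = 2 * (p - 1) - 2 * n - i by omega,
    show ((2 * n + i : ℕ) + 1 : ℚ) = 2 * (n : ℚ) + 1 + i by push_cast; ring] at h
  set x := (Nat.choose (2 * (p - 1) - 2 * n - i) (p - 1) : ℚ) * divB (p - 1)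
  constructor
  · rcases eq_or_ne x 0 with hx | hx
    · simp [hx]
    refine le_padicValRat_of_padicNorm_le hp hx ?_
    have hy : padicNorm p (-(1 / (2 * (n : ℚ) + 1 + i))) ≤ 1 := by
      rw [padicNorm.neg, padicNorm.div, padicNorm.one,
        show 2 * (n : ℚ) + 1 + i = (2 * n + 1 + i : ℕ) by push_cast; ring,
        padicNorm_natCast_eq_one (by omega) (by omega), div_one]
    have := padicNorm_add_le (h.trans (inv_le_one_of_one_le₀ (by exact_mod_cast hp.one_lt.le))) hy
    simpa using this
  · rcases eq_or_ne x (-(1 / (2 * (n : ℚ) + 1 + i))) with hx | hx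
    · exact Or.inl hx
    · exact Or.inr (le_padicValRat_of_padicNorm_le hp (sub_ne_zero.2 hx) (by simpa using h))
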